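/- Let S be the set of real numbers dbf*(τ, d)/d where τ ranges over nonempty finite sets of constrained-deadline tasks with positive real parameters satisfying dbf(τ,t) ≤ t for all t > 0, and d denotes the largest relative deadline in τ. Let S' be the subset of S obtained by additionally requiring d_i + p_i > d for every task τ_i=(e_i,d_i,p_i) in τ. Then sup S = sup S'. -/

import Mathlib

open Finset

/-- Demand bound function of a task `(e, d, p)` at time `t`. -/
noncomputable def dbf (e d p t : ℝ) : ℝ :=
  if t < d then 0 else ((⌊(t - d) / p⌋ : ℝ) + 1) * e

/-- Approximate demand bound function of a task `(e, d, p)` at time `t`. -/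
noncomputable def dbfStar (e d p t : ℝ) : ℝ :=
  if t < d then 0 else ((t - d) / p + 1) * e

/-- Modified demand function `f` of a task `(e, d, p)` at time `t`. -/
noncomputable def fmod (e d p t : ℝ) : ℝ :=
  if t < d + p then dbf e d p t else 2 * e

/-- The set of values `dbf*(τ, D)/D` over nonempty finite sets `τ` of constrained-deadline
tasks with positive real parameters satisfying `dbf(τ,t) ≤ t` for all `t > 0`, where `D` is
the largest relative deadline of `τ`. -/
def ratioSet : Set ℝ :=
  {r | ∃ (n : ℕ) (e d p : ℕ → ℝ) (D : ℝ), 0 < n ∧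
    (∀ i ∈ Finset.Icc 1 n, 0 < e i ∧ 0 < d i ∧ 0 < p i ∧ d i ≤ p i) ∧
    (∀ t : ℝ, 0 < t → ∑ i ∈ Finset.Icc 1 n, dbf (e i) (d i) (p i) t ≤ t) ∧
    (∃ i ∈ Finset.Icc 1 n, d i = D) ∧ (∀ i ∈ Finset.Icc 1 n, d i ≤ D) ∧
    r = (∑ i ∈ Finset.Icc 1 n, dbfStar (e i) (d i) (p i) D) / D}

/-- The subset of `ratioSet` where additionally `d_i + p_i > D` for every task. -/
def ratioSet' : Set ℝ :=
  {r | ∃ (n : ℕ) (e d p : ℕ → ℝ) (D : ℝ), 0 < n ∧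
    (∀ i ∈ Finset.Icc 1 n, 0 < e i ∧ 0 < d i ∧ 0 < p i ∧ d i ≤ p i) ∧
    (∀ t : ℝ, 0 < t → ∑ i ∈ Finset.Icc 1 n, dbf (e i) (d i) (p i) t ≤ t) ∧
    (∃ i ∈ Finset.Icc 1 n, d i = D) ∧ (∀ i ∈ Finset.Icc 1 n, d i ≤ D) ∧
    (∀ i ∈ Finset.Icc 1 n, d i + p i > D) ∧
    r = (∑ i ∈ Finset.Icc 1 n, dbfStar (e i) (d i) (p i) D) / D}

theorem dbf_nonneg {e d p t : ℝ} (he : 0 ≤ e) (hp : 0 ≤ p) : 0 ≤ dbf e d p t := by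
  unfold dbf
  split_ifs with h
  · exact le_rfl
  · have : (0 : ℝ) ≤ ⌊(t - d) / p⌋ :=
      mod_cast Int.floor_nonneg.mpr (div_nonneg (sub_nonneg.mpr (not_lt.mp h)) hp)
    positivity

/-- Merging each `k + 1` consecutive jobs of a task into a single job, due at the deadline of the
last one, does not increase the demand. -/
theorem dbf_merge_le {e d p : ℝ} {k : ℤ} (he : 0 ≤ e) (hp : 0 < p) (hk : 0 ≤ k) (t : ℝ) :
    dbf ((k + 1) * e) (d + k * p) ((k + 1) * p) t ≤ dbf e d p t := by
  have hk' : (0 : ℝ) ≤ k := mod_cast hk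
  by_cases h : t < d + k * p
  · rw [dbf, if_pos h]
    exact dbf_nonneg he hp.le
  have hd : ¬ t < d := by nlinarith
  rw [dbf, dbf, if_neg h, if_neg hd, ← mul_assoc]
  refine mul_le_mul_of_nonneg_right ?_ he
  set m := ⌊(t - (d + k * p)) / ((k + 1) * p)⌋
  have hm : (m : ℝ) * ((k + 1) * p) ≤ t - (d + k * p) :=
    (le_div_iff₀ (by positivity)).mp (Int.floor_le _)
  have hfloor : m * (k + 1) + k ≤ ⌊(t - d) / p⌋ := by
    rw [Int.le_floor, le_div_iff₀ hp]
    push_cast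
    linarith
  have hfloor' : (m : ℝ) * (k + 1) + k ≤ ⌊(t - d) / p⌋ := mod_cast hfloor
  linarith

/-- Merging consecutive jobs of a task preserves the approximate demand from the new deadline
on. -/
theorem dbfStar_merge_eq {e d p t : ℝ} {k : ℤ} (hp : 0 < p) (hk : 0 ≤ k) (ht : d + k * p ≤ t) :
    dbfStar ((k + 1) * e) (d + k * p) ((k + 1) * p) t = dbfStar e d p t := by
  have hk' : (0 : ℝ) ≤ k := mod_cast hk
  have hd : ¬ t < d := by nlinarith
  rw [dbfStar, dbfStar, if_neg ht.not_gt, if_neg hd]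
  field_simp
  ring

theorem ratioSet_eq_ratioSet' : ratioSet = ratioSet' := by
  ext r
  constructor
  · rintro ⟨n, e, d, p, D, hn, hpos, hdbf, ⟨j, hj, hjD⟩, hD, rfl⟩
    set k : ℕ → ℤ := fun i => ⌊(D - d i) / p i⌋
    have hk : ∀ i ∈ Icc 1 n, 0 ≤ k i := fun i hi =>
      Int.floor_nonneg.mpr (div_nonneg (sub_nonneg.mpr (hD i hi)) (hpos i hi).2.2.1.le)
    have hle : ∀ i ∈ Icc 1 n, d i + k i * p i ≤ D := fun i hi => by
      have := (le_div_iff₀ (hpos i hi).2.2.1).mp (Int.floor_le ((D - d i) / p i))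
      linarith
    refine ⟨n, fun i => (k i + 1) * e i, fun i => d i + k i * p i, fun i => (k i + 1) * p i, D, hn,
      fun i hi => ?_, fun t ht => ?_, ⟨j, hj, ?_⟩, hle, fun i hi => ?_, ?_⟩
    · obtain ⟨he, hd, hp, hdp⟩ := hpos i hi
      have hk' : (0 : ℝ) ≤ k i := mod_cast hk i hi
      exact ⟨by positivity, by positivity, by positivity, by linarith⟩
    · exact (sum_le_sum fun i hi =>
        dbf_merge_le (hpos i hi).1.le (hpos i hi).2.2.1 (hk i hi) t).trans (hdbf t ht)
    · simp [k, hjD]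
    · obtain ⟨-, -, hp, -⟩ := hpos i hi
      have hk' : (0 : ℝ) ≤ k i := mod_cast hk i hi
      have := (div_lt_iff₀ hp).mp (Int.lt_floor_add_one ((D - d i) / p i))
      have := mul_nonneg hk' hp.le
      change D < d i + k i * p i + (k i + 1) * p i
      linarith
    · rw [sum_congr rfl fun i hi => dbfStar_merge_eq (hpos i hi).2.2.1 (hk i hi) (hle i hi)]
  · rintro ⟨n, e, d, p, D, hn, hpos, hdbf, hex, hD, -, hr⟩
    exact ⟨n, e, d, p, D, hn, hpos, hdbf, hex, hD, hr⟩

/-- the supremum of the ratio `dbf*(τ,D)/D` is unchanged when one additionally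
requires `d_i + p_i > D` for every task of `τ`. -/
theorem stmt13 : sSup ratioSet = sSup ratioSet' := by
  rw [ratioSet_eq_ratioSet']
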